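/- arXiv:quant-ph/0311007 — 5 statements merged into one kernel-verified Lean document; each statement's English description precedes it below -/
import Mathlib

section
/- For every natural number n ≥ 1 and every real number c with 1 ≤ c ≤ √n/6, if k is a natural number with k = n/2 + c√n (as real numbers), then the binomial coefficient satisfies C(n, k) > e^{-6c² - 2} · 2^n / √(2πn). -/
open Real

/-- An upper bound for the factorial of Stirling type, valid for all positive integers. -/
theorem factorial_le_exp_one_mul_sqrt {m : ℕ} (hm : m ≠ 0) :
    (m.factorial : ℝ) ≤ exp 1 * √m * (m / exp 1) ^ m := by
  obtain ⟨l, rfl⟩ := Nat.exists_eq_succ_of_ne_zero hm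
  have h : Stirling.stirlingSeq (l + 1) ≤ Stirling.stirlingSeq 1 :=
    Stirling.stirlingSeq'_antitone (Nat.zero_le l)
  rw [Stirling.stirlingSeq_one, Stirling.stirlingSeq, div_le_iff₀ (by positivity),
    Real.sqrt_mul (by norm_num)] at h
  refine h.trans_eq ?_
  have h2 : √(2 : ℝ) ≠ 0 := by positivity
  field_simp

/-- A product of two factorials is at most what Stirling's formula gives near the middle. -/
theorem factorial_mul_factorial_le {k j : ℕ} (hk : k ≠ 0) (hj : j ≠ 0) {a t : ℝ}
    (ha : 0 < a) (hka : (k : ℝ) = a * (1 + t)) (hja : (j : ℝ) = a * (1 - t)) :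
    (k.factorial : ℝ) * j.factorial ≤
      exp 2 * a * (a / exp 1) ^ (k + j) * exp (2 * a * t ^ 2) := by
  have hk' : (k / exp 1 : ℝ) ^ k ≤ (a / exp 1) ^ k * exp (k * t) := by
    rw [Real.exp_nat_mul, ← mul_pow]
    gcongr
    rw [hka, div_mul_eq_mul_div]
    gcongr
    linarith [Real.add_one_le_exp t]
  have hj' : (j / exp 1 : ℝ) ^ j ≤ (a / exp 1) ^ j * exp (j * (-t)) := by
    rw [Real.exp_nat_mul, ← mul_pow]
    gcongr
    rw [hja, div_mul_eq_mul_div]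
    gcongr
    linarith [Real.add_one_le_exp (-t)]
  have hs : √(k : ℝ) * √(j : ℝ) ≤ a := by
    rw [← Real.sqrt_mul (by positivity)]
    refine Real.sqrt_le_iff.2 ⟨ha.le, ?_⟩
    rw [hka, hja]
    nlinarith [sq_nonneg (a * t)]
  have he : exp (k * t) * exp (j * (-t)) = exp (2 * a * t ^ 2) := by
    rw [← Real.exp_add, hka, hja]
    ring_nf
  have he2 : exp 1 * exp 1 = exp 2 := by
    rw [← Real.exp_add]
    norm_num
  calc (k.factorial : ℝ) * j.factorial
      ≤ (exp 1 * √k * (k / exp 1) ^ k) * (exp 1 * √j * (j / exp 1) ^ j) := by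
        gcongr
        · exact factorial_le_exp_one_mul_sqrt hk
        · exact factorial_le_exp_one_mul_sqrt hj
    _ ≤ (exp 1 * √k * ((a / exp 1) ^ k * exp (k * t))) *
          (exp 1 * √j * ((a / exp 1) ^ j * exp (j * (-t)))) := by gcongr
    _ = (exp 1 * exp 1) * (√k * √j) * (a / exp 1) ^ (k + j) *
          (exp (k * t) * exp (j * (-t))) := by ring
    _ ≤ exp 2 * a * (a / exp 1) ^ (k + j) * exp (2 * a * t ^ 2) := by
        rw [he, he2]
        gcongr

/-- Lemma 6.1 of the paper: for `1 ≤ c ≤ √n/6`, if `k = n/2 + c√n` is a natural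
number then `C(n,k) > e^{-6c²-2} 2ⁿ / √(2πn)`. -/
theorem boolean_mean_binom_lower_bound (n : ℕ) (hn : 1 ≤ n) (c : ℝ)
    (hc1 : 1 ≤ c) (hc2 : c ≤ Real.sqrt n / 6)
    (k : ℕ) (hk : (k : ℝ) = (n : ℝ) / 2 + c * Real.sqrt n) :
    (n.choose k : ℝ) > Real.exp (-6 * c ^ 2 - 2) * 2 ^ n / Real.sqrt (2 * π * n) := by
  have hn0 : (0 : ℝ) < n := by exact_mod_cast hn
  have hs0 : 0 < √(n : ℝ) := Real.sqrt_pos.2 hn0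
  have hs : √(n : ℝ) * √(n : ℝ) = n := Real.mul_self_sqrt hn0.le
  have hkn : (k : ℝ) < n := by nlinarith
  have hkn' : k < n := by exact_mod_cast hkn
  have hk0 : k ≠ 0 := by
    rintro rfl
    have : 0 < c * √(n : ℝ) := by positivity
    push_cast at hk
    linarith
  have hdiv : (n : ℝ) / 2 * (2 * c / √n) = c * √n := by
    field_simp
    linarith
  have hprod := factorial_mul_factorial_le (k := k) (j := n - k) (a := n / 2)
    (t := 2 * c / √n) hk0 (by omega) (by positivity) (by linarith)
    (by rw [Nat.cast_sub hkn'.le]; linarith)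
  have hexp : 2 * ((n : ℝ) / 2) * (2 * c / √n) ^ 2 = 4 * c ^ 2 := by
    rw [div_pow, Real.sq_sqrt hn0.le]
    field_simp
    ring
  rw [hexp, Nat.add_sub_cancel' hkn'.le] at hprod
  have hchoose : (n.choose k : ℝ) * (k.factorial * (n - k).factorial) = n.factorial := by
    rw [← mul_assoc]
    exact_mod_cast Nat.choose_mul_factorial_mul_factorial hkn'.le
  have hfac := Stirling.le_factorial_stirling n
  have hr : √(2 * π * n) * √(2 * π * n) = 2 * π * n := Real.mul_self_sqrt (by positivity)
  have hr0 : 0 < √(2 * π * n) := by positivity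
  have hlt : exp (-6 * c ^ 2 - 2) * exp 2 * exp (4 * c ^ 2) * (n / 2) < 2 * π * n := by
    rw [← Real.exp_add, ← Real.exp_add]
    have : exp (-6 * c ^ 2 - 2 + 2 + 4 * c ^ 2) ≤ 1 :=
      Real.exp_le_one_iff.2 (by nlinarith [sq_nonneg c])
    nlinarith [Real.pi_gt_three]
  rw [gt_iff_lt, div_lt_iff₀ hr0]
  refine lt_of_mul_lt_mul_right ?_
    (by positivity : (0 : ℝ) ≤ k.factorial * (n - k).factorial)
  calc exp (-6 * c ^ 2 - 2) * 2 ^ n * (k.factorial * (n - k).factorial)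
      ≤ exp (-6 * c ^ 2 - 2) * 2 ^ n *
          (exp 2 * (n / 2) * (n / 2 / exp 1) ^ n * exp (4 * c ^ 2)) := by gcongr
    _ = (exp (-6 * c ^ 2 - 2) * exp 2 * exp (4 * c ^ 2) * (n / 2)) * (n / exp 1) ^ n := by
        have : (n / exp 1 : ℝ) ^ n = 2 ^ n * (n / 2 / exp 1) ^ n := by
          rw [← mul_pow]
          congr 1
          ring
        rw [this]
        ring
    _ < 2 * π * n * (n / exp 1) ^ n := by gcongr
    _ = √(2 * π * n) * (√(2 * π * n) * (n / exp 1) ^ n) := by rw [← mul_assoc, hr]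
    _ ≤ √(2 * π * n) * n.factorial := by gcongr
    _ = n.choose k * √(2 * π * n) * (k.factorial * (n - k).factorial) := by
        rw [← hchoose]
        ring
end

section
/- Let m ≥ 1 be an integer and let n be a natural number with 6(m+1) ≤ √n. Then for every natural number k with m√n ≤ |k - n/2| ≤ (m+1)√n, the binomial coefficient satisfies C(n, k) · 2^{-n} > e^{-6(m+1)² - 2} · (2πn)^{-1/2}. -/
open Real

theorem factorial_le_exp_mul_sqrt_mul_pow {k : ℕ} (hk : 0 < k) :
    (k.factorial : ℝ) ≤ exp 1 * √k * (k / exp 1) ^ k := by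
  obtain ⟨l, rfl⟩ := Nat.exists_eq_succ_of_ne_zero hk.ne'
  have h : Stirling.stirlingSeq (l + 1) ≤ Stirling.stirlingSeq 1 :=
    Stirling.stirlingSeq'_antitone (Nat.zero_le l)
  rw [Stirling.stirlingSeq_one, Stirling.stirlingSeq, div_le_iff₀ (by positivity)] at h
  refine h.trans_eq ?_
  rw [Real.sqrt_mul (by norm_num)]
  field_simp

theorem pow_le_exp_mul_sub_one {x : ℝ} (hx : 0 ≤ x) (k : ℕ) :
    x ^ k ≤ exp (k * (x - 1)) := by
  rw [Real.exp_nat_mul]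
  exact pow_le_pow_left₀ hx (by linarith [Real.add_one_le_exp (x - 1)]) k

/-- A Gaussian lower bound for the binomial probability, up to the factor `4 * π / exp 2`. -/
theorem choose_div_two_pow_lower_bound {k j : ℕ} (hk : 0 < k) (hj : 0 < j) :
    4 * π * exp (-((k : ℝ) - j) ^ 2 / (k + j) - 2) ≤
      ((k + j).choose k : ℝ) / 2 ^ (k + j) * √(2 * π * (k + j : ℝ)) := by
  have hk' : (0 : ℝ) < k := by exact_mod_cast hk
  have hj' : (0 : ℝ) < j := by exact_mod_cast hj
  set n : ℝ := k + j with hn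
  have hn0 : 0 < n := by positivity
  set A : ℝ := (2 * k / n) ^ k * (2 * j / n) ^ j with hA
  have hA0 : 0 < A := by positivity
  have hAle : A ≤ exp (((k : ℝ) - j) ^ 2 / n) := by
    calc A ≤ exp (k * (2 * k / n - 1)) * exp (j * (2 * j / n - 1)) :=
          mul_le_mul (pow_le_exp_mul_sub_one (by positivity) k)
            (pow_le_exp_mul_sub_one (by positivity) j) (by positivity) (by positivity)
      _ = exp (((k : ℝ) - j) ^ 2 / n) := by
          rw [← Real.exp_add]
          congr 1
          field_simp
          rw [hn]
          ring
  have hfac : ((k + j).choose k : ℝ) * k.factorial * j.factorial = (k + j).factorial := by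
    have := Nat.choose_mul_factorial_mul_factorial (Nat.le_add_right k j)
    rw [Nat.add_sub_cancel_left] at this
    exact_mod_cast this
  have hst : √(2 * π * n) * (n / exp 1) ^ (k + j) ≤ ((k + j).factorial : ℝ) := by
    have := Stirling.le_factorial_stirling (k + j)
    push_cast at this
    exact this
  have hpow : ((k : ℝ) / exp 1) ^ k * (j / exp 1) ^ j
      = A / 2 ^ (k + j) * (n / exp 1) ^ (k + j) := by
    rw [hA]
    simp only [div_pow, mul_pow, pow_add]
    field_simp
  have hsq : √(k : ℝ) * √(j : ℝ) ≤ n / 2 := by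
    nlinarith [sq_nonneg (√(k : ℝ) - √(j : ℝ)), Real.sq_sqrt hk'.le, Real.sq_sqrt hj'.le]
  set c : ℝ := ((k + j).choose k : ℝ) with hc
  have hc0 : 0 ≤ c := by positivity
  set s : ℝ := √(2 * π * n) with hs
  have hs0 : 0 < s := by positivity
  have hs2 : s * s = 2 * π * n := Real.mul_self_sqrt (by positivity)
  have key : s ≤ c / 2 ^ (k + j) * (exp 2 * (n / 2) * exp (((k : ℝ) - j) ^ 2 / n)) := by
    refine le_of_mul_le_mul_right ?_ (show 0 < (n / exp 1) ^ (k + j) by positivity)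
    calc s * (n / exp 1) ^ (k + j) ≤ c * k.factorial * j.factorial := hst.trans_eq hfac.symm
      _ ≤ c * (exp 1 * √k * (k / exp 1) ^ k) * (exp 1 * √j * (j / exp 1) ^ j) := by
          gcongr
          · exact factorial_le_exp_mul_sqrt_mul_pow hk
          · exact factorial_le_exp_mul_sqrt_mul_pow hj
      _ = c * (exp 1 * exp 1) * (√k * √j) * (((k : ℝ) / exp 1) ^ k * (j / exp 1) ^ j) := by ring
      _ = c / 2 ^ (k + j) * (exp 2 * (√k * √j) * A) * (n / exp 1) ^ (k + j) := by
          rw [hpow, ← Real.exp_add, one_add_one_eq_two]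
          ring
      _ ≤ _ := by gcongr
  have h := mul_le_mul_of_nonneg_right key hs0.le
  rw [hs2] at h
  have hE : exp (-((k : ℝ) - j) ^ 2 / n - 2) = 1 / (exp 2 * exp (((k : ℝ) - j) ^ 2 / n)) := by
    rw [← Real.exp_add, one_div, ← Real.exp_neg]
    congr 1
    ring
  rw [hE, mul_one_div, div_le_iff₀ (by positivity)]
  refine le_of_mul_le_mul_right ?_ (half_pos hn0)
  linarith

/-- The binomial bound used in the proof of Lemma 3.1 of the paper: for `m ≥ 1`,
`6(m+1) ≤ √n` and `k` with `m√n ≤ |k - n/2| ≤ (m+1)√n`, one has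
`C(n,k) 2^{-n} > e^{-6(m+1)²-2} (2πn)^{-1/2}`. -/
theorem binom_lower_bound_band (m : ℕ) (hm : 1 ≤ m) (n : ℕ)
    (hn : 6 * ((m : ℝ) + 1) ≤ Real.sqrt n)
    (k : ℕ) (h1 : (m : ℝ) * Real.sqrt n ≤ |(k : ℝ) - (n : ℝ) / 2|)
    (h2 : |(k : ℝ) - (n : ℝ) / 2| ≤ ((m : ℝ) + 1) * Real.sqrt n) :
    (n.choose k : ℝ) / 2 ^ n >
      Real.exp (-6 * ((m : ℝ) + 1) ^ 2 - 2) / Real.sqrt (2 * π * n) := by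
  set d : ℝ := (k : ℝ) - (n : ℝ) / 2 with hd
  set C : ℝ := (m : ℝ) + 1 with hC
  have hC0 : 0 < C := by positivity
  have hs0 : 0 < √(n : ℝ) := by linarith
  have hn0 : (0 : ℝ) < n := Real.sqrt_pos.mp hs0
  have hs2 : √(n : ℝ) * √(n : ℝ) = n := Real.mul_self_sqrt hn0.le
  have hdn : |d| ≤ n / 6 := by nlinarith
  obtain ⟨hd1, hd2⟩ := abs_le.mp hdn
  have hkn : k ≤ n := by
    have : (k : ℝ) ≤ n := by linarith
    exact_mod_cast this
  obtain ⟨j, rfl⟩ := Nat.exists_eq_add_of_le hkn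
  push_cast at *
  have hk : 0 < k := by
    have : (0 : ℝ) < k := by linarith
    exact_mod_cast this
  have hj : 0 < j := by
    have : (0 : ℝ) < j := by linarith
    exact_mod_cast this
  have hexp : -6 * C ^ 2 - 2 ≤ -((k : ℝ) - j) ^ 2 / (k + j) - 2 := by
    have hsq : d ^ 2 ≤ C ^ 2 * (k + j) := by
      calc d ^ 2 = |d| ^ 2 := (sq_abs d).symm
        _ ≤ (C * √((k : ℝ) + j)) ^ 2 := by gcongr
        _ = C ^ 2 * (k + j) := by rw [mul_pow, Real.sq_sqrt hn0.le]
    have hkj : (k : ℝ) - j = 2 * d := by rw [hd]; ring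
    have : -6 * C ^ 2 ≤ -((k : ℝ) - j) ^ 2 / (k + j) := by
      rw [le_div_iff₀ hn0, hkj]
      nlinarith [mul_pos (pow_pos hC0 2) hn0]
    linarith
  rw [gt_iff_lt, div_lt_iff₀ (by positivity)]
  refine lt_of_lt_of_le ?_ (choose_div_two_pow_lower_bound hk hj)
  have h := Real.exp_le_exp.mpr hexp
  nlinarith [Real.pi_gt_three, Real.exp_pos (-((k : ℝ) - j) ^ 2 / (k + j) - 2)]
end

section
/- Let n be a natural number, c a real number with 0 < 2c < √n, and suppose k is a natural number with k = n/2 + c√n (as real numbers) and k ≤ n. Then the binomial coefficient satisfies C(n, k) > (2^n / (e² √(2πn))) · ((√n - 2c)/(√n + 2c))^{c√n}. -/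
open Real

/-- Upper Stirling bound `n! ≤ e √n (n/e)ⁿ` for positive `n`. -/
theorem factorial_le_exp_one_mul_sqrt_mul_pow {n : ℕ} (hn : 0 < n) :
    (n.factorial : ℝ) ≤ exp 1 * √n * ((n : ℝ) ^ n / exp 1 ^ n) := by
  obtain ⟨m, rfl⟩ : ∃ m, n = m + 1 := ⟨n - 1, by omega⟩
  have h : Stirling.stirlingSeq (m + 1) ≤ Stirling.stirlingSeq 1 :=
    Stirling.stirlingSeq'_antitone (Nat.zero_le m)
  rw [Stirling.stirlingSeq_one, Stirling.stirlingSeq, div_le_iff₀ (by positivity),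
    Real.sqrt_mul (by norm_num), div_pow] at h
  refine h.trans_eq ?_
  have h2 : √(2 : ℝ) ≠ 0 := by positivity
  field_simp

/-- For `k, m > 0`, `kᵏ mᵐ (m/k)^((k-m)/2) 2^(k+m) ≤ (k+m)^(k+m)`. -/
theorem pow_mul_pow_mul_rpow_mul_two_pow_le {k m : ℕ} (hm : 0 < m) (hmk : m ≤ k) :
    (k : ℝ) ^ k * (m : ℝ) ^ m * ((m : ℝ) / k) ^ (((k : ℝ) - m) / 2) * 2 ^ (k + m) ≤
      ((k : ℝ) + m) ^ (k + m) := by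
  obtain ⟨d, rfl⟩ := Nat.exists_eq_add_of_le hmk
  have hk0 : (0 : ℝ) < ((m + d : ℕ) : ℝ) := by exact_mod_cast (by omega : 0 < m + d)
  have hm0 : (0 : ℝ) < m := by exact_mod_cast hm
  have hd : ((m + d : ℕ) : ℝ) - m = d := by push_cast; ring
  rw [hd]
  generalize ((m + d : ℕ) : ℝ) = x at *
  have hT : ((m / x) ^ ((d : ℝ) / 2)) ^ 2 = m ^ d / x ^ d := by
    rw [← Real.rpow_natCast, ← Real.rpow_mul (by positivity), ← div_pow,
      ← Real.rpow_natCast]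
    congr 1
    push_cast
    ring
  refine le_of_sq_le_sq ?_ (by positivity)
  rw [mul_pow, mul_pow _ (_ ^ ((d : ℝ) / 2)), hT]
  calc (x ^ (m + d) * (m : ℝ) ^ m) ^ 2 * (m ^ d / x ^ d) * (2 ^ (m + d + m)) ^ 2
      = (4 * x * m) ^ (m + d + m) := by
        rw [pow_right_comm 2, show (2 : ℝ) ^ 2 = 4 by norm_num, mul_pow (4 * x), mul_pow 4]
        field_simp
        ring
    _ ≤ ((x + m) ^ 2) ^ (m + d + m) := by
        gcongr
        nlinarith [sq_nonneg (x - m)]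
    _ = _ := by rw [← pow_mul, ← pow_mul, mul_comm]

/-- A lower bound for the binomial coefficient `C(k+m, k)` with `0 < m ≤ k`. -/
theorem two_pow_div_mul_rpow_lt_choose {k m : ℕ} (hm : 0 < m) (hmk : m ≤ k) :
    2 ^ (k + m) / (exp 1 ^ 2 * √(2 * π * ((k + m : ℕ) : ℝ))) *
      ((m : ℝ) / k) ^ (((k : ℝ) - m) / 2) < ((k + m).choose k : ℝ) := by
  have hk : 0 < k := by omega
  have hm0 : (0 : ℝ) < m := by exact_mod_cast hm
  have hk0 : (0 : ℝ) < k := by exact_mod_cast hk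
  have hle := pow_mul_pow_mul_rpow_mul_two_pow_le hm hmk
  have hlow := Stirling.le_factorial_stirling (k + m)
  have hfk := factorial_le_exp_one_mul_sqrt_mul_pow hk
  have hfm := factorial_le_exp_one_mul_sqrt_mul_pow hm
  have hC : ((k + m).choose k : ℝ) * k.factorial * m.factorial = (k + m).factorial := by
    have h := Nat.choose_mul_factorial_mul_factorial (Nat.le_add_right k m)
    rw [Nat.add_sub_cancel_left] at h
    exact_mod_cast h
  have hC0 : (0 : ℝ) < ((k + m).choose k : ℝ) := by
    exact_mod_cast Nat.choose_pos (by omega)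
  have hT : 0 < ((m : ℝ) / k) ^ (((k : ℝ) - m) / 2) := by positivity
  have hS : 0 < √(2 * π * ((k + m : ℕ) : ℝ)) := by push_cast; positivity
  have hS2 : √(2 * π * ((k + m : ℕ) : ℝ)) ^ 2 = 2 * π * (k + m) := by
    rw [Real.sq_sqrt (by positivity)]; push_cast; ring
  have hkm : √(k : ℝ) * √(m : ℝ) < √(2 * π * ((k + m : ℕ) : ℝ)) ^ 2 := by
    rw [hS2]
    nlinarith [Real.sq_sqrt hk0.le, Real.sq_sqrt hm0.le, sq_nonneg (√(k : ℝ) - √(m : ℝ)),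
      Real.pi_gt_three]
  generalize √(2 * π * ((k + m : ℕ) : ℝ)) = S at *
  generalize ((m : ℝ) / k) ^ (((k : ℝ) - m) / 2) = T at *
  generalize ((k + m).choose k : ℝ) = C at *
  have hA : 0 < (k : ℝ) ^ k * (m : ℝ) ^ m := by positivity
  have hup : S * ((k : ℝ) + m) ^ (k + m) ≤
      C * exp 1 ^ 2 * (√(k : ℝ) * √(m : ℝ)) * ((k : ℝ) ^ k * (m : ℝ) ^ m) := by
    have h : S * (((k + m : ℕ) : ℝ) / exp 1) ^ (k + m) ≤
        C * (exp 1 * √k * ((k : ℝ) ^ k / exp 1 ^ k)) *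
          (exp 1 * √m * ((m : ℝ) ^ m / exp 1 ^ m)) := by
      refine hlow.trans (hC.symm.le.trans ?_)
      gcongr
    rw [div_pow, ← mul_div_assoc, div_le_iff₀ (by positivity)] at h
    push_cast at h
    refine h.trans_eq ?_
    rw [pow_add (exp 1)]
    field_simp
  have hmain : S * (T * 2 ^ (k + m)) ≤ C * exp 1 ^ 2 * (√(k : ℝ) * √(m : ℝ)) := by
    refine le_of_mul_le_mul_right ?_ hA
    refine le_trans (le_of_eq ?_) ((mul_le_mul_of_nonneg_left hle hS.le).trans hup)
    ring
  have hfin : S * (T * 2 ^ (k + m)) < S * (C * (exp 1 ^ 2 * S)) := by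
    refine hmain.trans_lt ((mul_lt_mul_of_pos_left hkm (by positivity)).trans_eq ?_)
    ring
  rw [div_mul_eq_mul_div, div_lt_iff₀ (by positivity), mul_comm _ T]
  exact lt_of_mul_lt_mul_left hfin hS.le

/-- Intermediate inequality from the proof of Lemma 6.1 of the paper: if
`0 < 2c < √n` and `k = n/2 + c√n ≤ n` is a natural number, then
`C(n,k) > (2ⁿ/(e²√(2πn))) ((√n - 2c)/(√n + 2c))^{c√n}`. -/
theorem binom_lower_intermediate (n : ℕ) (c : ℝ) (hc : 0 < 2 * c)
    (hc2 : 2 * c < Real.sqrt n) (k : ℕ)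
    (hk : (k : ℝ) = (n : ℝ) / 2 + c * Real.sqrt n) (hkn : k ≤ n) :
    (n.choose k : ℝ) >
      2 ^ n / (Real.exp 1 ^ 2 * Real.sqrt (2 * π * n)) *
        ((Real.sqrt n - 2 * c) / (Real.sqrt n + 2 * c)) ^ (c * Real.sqrt n) := by
  obtain ⟨m, rfl⟩ := Nat.exists_eq_add_of_le hkn
  have hs : 0 < √((k + m : ℕ) : ℝ) := hc.trans hc2
  have hsq : √((k + m : ℕ) : ℝ) ^ 2 = k + m := by
    rw [Real.sq_sqrt (by positivity)]; push_cast; ring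
  have hcs : c * √((k + m : ℕ) : ℝ) = ((k : ℝ) - m) / 2 := by
    push_cast at hk ⊢; linarith
  have hm0 : (0 : ℝ) < m := by nlinarith
  have hmk : (m : ℝ) ≤ k := by nlinarith
  have hk0 : (0 : ℝ) < k := hm0.trans_le hmk
  have hratio : (√((k + m : ℕ) : ℝ) - 2 * c) / (√((k + m : ℕ) : ℝ) + 2 * c) = (m : ℝ) / k := by
    rw [div_eq_div_iff (by positivity) hk0.ne']
    refine mul_left_cancel₀ hs.ne' ?_
    linear_combination ((k : ℝ) - m) * hsq - 2 * ((k : ℝ) + m) * hcs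
  rw [hratio, hcs]
  exact two_pow_div_mul_rpow_lt_choose (by exact_mod_cast hm0) (by exact_mod_cast hmk)
end

section
/- For every natural number n and every real number c with 0 < c and 6c ≤ √n, one has ((√n + 2c)/(√n - 2c))^{c√n} < e^{6c²}. -/
open Real

/-- Inequality from the Appendix of the paper (proof of Lemma 6.1): for `c > 0`
with `6c ≤ √n`, `((√n + 2c)/(√n - 2c))^{c√n} < e^{6c²}`. -/
theorem ratio_rpow_lt_exp (n : ℕ) (c : ℝ) (hc : 0 < c) (h : 6 * c ≤ Real.sqrt n) :
    ((Real.sqrt n + 2 * c) / (Real.sqrt n - 2 * c)) ^ (c * Real.sqrt n) <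
      Real.exp (6 * c ^ 2) := by
  set s := Real.sqrt n
  have hs : 0 < s := by linarith
  have hd : 0 < s - 2 * c := by linarith
  have hr : 0 < (s + 2 * c) / (s - 2 * c) := by positivity
  have hr_ne : (s + 2 * c) / (s - 2 * c) ≠ 1 := by
    rw [Ne, div_eq_one_iff_eq hd.ne']
    linarith
  have hr_sub : (s + 2 * c) / (s - 2 * c) - 1 ≤ 6 * c / s := by
    rw [div_sub_one hd.ne', div_le_div_iff₀ hd hs]
    nlinarith
  have hlog : Real.log ((s + 2 * c) / (s - 2 * c)) < 6 * c / s :=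
    (Real.log_lt_sub_one_of_pos hr hr_ne).trans_le hr_sub
  rw [Real.rpow_def_of_pos hr, Real.exp_lt_exp]
  calc Real.log ((s + 2 * c) / (s - 2 * c)) * (c * s)
      < 6 * c / s * (c * s) := by gcongr
    _ = 6 * c ^ 2 := by field_simp
end

section
/- Let J be a nonempty finite set of integers, b a positive integer, and D a real number with D ≥ b. Suppose that for every pair j, k ∈ J either |j - k| < b or |j - k| > D. Then max J - min J ≥ D · (⌈|J|/b⌉ - 1). -/
/-- A set of more than `b * n` integers, any two of which differ by less than `b` or by more than
`D`, contains two elements at distance at least `n * D`. -/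
theorem exists_mul_le_sub_of_mul_lt_card (b : ℕ) (D : ℝ) (n : ℕ) (J : Finset ℤ)
    (hcard : b * n < J.card)
    (h : ∀ j ∈ J, ∀ k ∈ J, ((|j - k| : ℤ) : ℝ) < b ∨ ((|j - k| : ℤ) : ℝ) > D) :
    ∃ x ∈ J, ∃ y ∈ J, n * D ≤ ((y - x : ℤ) : ℝ) := by
  induction n generalizing J with
  | zero =>
    obtain ⟨x, hx⟩ := Finset.card_pos.mp (by simpa using hcard)
    exact ⟨x, hx, x, hx, by simp⟩
  | succ n ih =>
    have hJ : J.Nonempty := Finset.card_pos.mp (by omega)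
    set m := J.min' hJ
    have hm : m ∈ J := J.min'_mem hJ
    have hfirst : (J.filter (· < m + b)).card ≤ b := by
      have hsub : J.filter (· < m + b) ⊆ Finset.Ico m (m + b) := fun x hx => by
        rw [Finset.mem_filter] at hx
        exact Finset.mem_Ico.mpr ⟨J.min'_le x hx.1, hx.2⟩
      simpa using Finset.card_le_card hsub
    have hsplit := J.card_filter_add_card_filter_not (· < m + (b : ℤ))
    rw [Nat.mul_succ] at hcard
    obtain ⟨x, hx, y, hy, hxy⟩ := ih (J.filter (¬ · < m + b)) (by omega) fun j hj k hk =>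
      h j (Finset.mem_of_mem_filter j hj) k (Finset.mem_of_mem_filter k hk)
    rw [Finset.mem_filter] at hx hy
    refine ⟨m, hm, y, hy.1, ?_⟩
    have hxm : (b : ℤ) ≤ x - m := by linarith [hx.2]
    have hfar := h x hx.1 m hm
    rw [abs_of_nonneg (by omega)] at hfar
    have hxm' : (b : ℝ) ≤ ((x - m : ℤ) : ℝ) := by exact_mod_cast hxm
    have hD := hfar.resolve_left hxm'.not_gt
    push_cast at hxy hD ⊢
    linarith


/-- Pigeonhole/grouping claim from the proof of Theorem 3.1 of the paper: if the
elements of a finite set `J` of integers pairwise differ either by less than `b`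
or by more than `D ≥ b`, then `max J - min J ≥ D(⌈|J|/b⌉ - 1)`. -/
theorem cluster_spread (J : Finset ℤ) (hJ : J.Nonempty) (b : ℕ) (hb : 0 < b)
    (D : ℝ) (hD : (b : ℝ) ≤ D)
    (h : ∀ j ∈ J, ∀ k ∈ J, ((|j - k| : ℤ) : ℝ) < b ∨ ((|j - k| : ℤ) : ℝ) > D) :
    ((J.max' hJ - J.min' hJ : ℤ) : ℝ) ≥ D * ((⌈(J.card : ℝ) / b⌉ : ℤ) - 1) := by
  have hpos : 0 < J.card := hJ.card_pos
  set n := (J.card - 1) / b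
  have hlt : b * n < J.card := by
    have : b * n ≤ J.card - 1 := Nat.mul_div_le (J.card - 1) b
    omega
  have hle : J.card ≤ (n + 1) * b := by
    have := Nat.lt_mul_of_div_lt (Nat.lt_succ_self n) hb
    rw [Nat.succ_eq_add_one] at this
    omega
  have hceil : (⌈(J.card : ℝ) / b⌉ : ℤ) ≤ (n : ℤ) + 1 := by
    rw [Int.ceil_le, div_le_iff₀ (by exact_mod_cast hb)]
    exact_mod_cast hle
  have hceil' : ((⌈(J.card : ℝ) / b⌉ : ℤ) : ℝ) - 1 ≤ n := by
    rw [sub_le_iff_le_add]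
    exact_mod_cast hceil
  have hD0 : 0 ≤ D := b.cast_nonneg.trans hD
  obtain ⟨x, hx, y, hy, hxy⟩ := exists_mul_le_sub_of_mul_lt_card b D n J hlt h
  calc D * ((⌈(J.card : ℝ) / b⌉ : ℤ) - 1) ≤ D * n := by gcongr
    _ = n * D := mul_comm _ _
    _ ≤ ((y - x : ℤ) : ℝ) := hxy
    _ ≤ ((J.max' hJ - J.min' hJ : ℤ) : ℝ) := by
      exact_mod_cast sub_le_sub (J.le_max' y hy) (J.min'_le x hx)
end
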